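/- Let H be a hypergraph satisfying Condition (A') and K a field. Then L_K(H) is neither left nor right Noetherian: there is a strictly increasing infinite chain of left ideals of L_K(H), and a strictly increasing infinite chain of right ideals of L_K(H). -/

import Mathlib

open scoped Classical

/-- The generators of the Leavitt path algebra of a hypergraph `H = (H0, H1, s, r)`:
a vertex generator `v` for every `v ∈ H0`, and generators `h_{ij}` (`edge`) and
`h_{ij}^*` (`ghost`) for every hyperedge `h ∈ H1`, `1 ≤ i ≤ |s(h)|`, `1 ≤ j ≤ |r(h)|`.
The multisets `s(h)` and `r(h)` are given as (enumerated) lists over `H0`. -/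
inductive HGen (H0 H1 : Type) (s r : H1 → List H0) : Type
  | vertex (v : H0) : HGen H0 H1 s r
  | edge (h : H1) (i : Fin (s h).length) (j : Fin (r h).length) : HGen H0 H1 s r
  | ghost (h : H1) (i : Fin (s h).length) (j : Fin (r h).length) : HGen H0 H1 s r

namespace HLPA

variable (K : Type) [Field K] (H0 H1 : Type) (s r : H1 → List H0)

/-- The defining relations (i)-(iv) of the Leavitt path algebra of a hypergraph,
imposed on the free algebra on the generators. -/
inductive Rel : FreeAlgebra K (HGen H0 H1 s r) → FreeAlgebra K (HGen H0 H1 s r) → Prop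
  | vtx (u v : H0) :
      Rel (FreeAlgebra.ι K (HGen.vertex u : HGen H0 H1 s r) * FreeAlgebra.ι K (HGen.vertex v))
        (if u = v then FreeAlgebra.ι K (HGen.vertex u : HGen H0 H1 s r) else 0)
  | src_edge (h : H1) (i : Fin (s h).length) (j : Fin (r h).length) :
      Rel (FreeAlgebra.ι K (HGen.vertex ((s h).get i) : HGen H0 H1 s r) *
            FreeAlgebra.ι K (HGen.edge h i j))
        (FreeAlgebra.ι K (HGen.edge h i j))
  | edge_rng (h : H1) (i : Fin (s h).length) (j : Fin (r h).length) :
      Rel (FreeAlgebra.ι K (HGen.edge h i j : HGen H0 H1 s r) *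
            FreeAlgebra.ι K (HGen.vertex ((r h).get j)))
        (FreeAlgebra.ι K (HGen.edge h i j))
  | rng_ghost (h : H1) (i : Fin (s h).length) (j : Fin (r h).length) :
      Rel (FreeAlgebra.ι K (HGen.vertex ((r h).get j) : HGen H0 H1 s r) *
            FreeAlgebra.ι K (HGen.ghost h i j))
        (FreeAlgebra.ι K (HGen.ghost h i j))
  | ghost_src (h : H1) (i : Fin (s h).length) (j : Fin (r h).length) :
      Rel (FreeAlgebra.ι K (HGen.ghost h i j : HGen H0 H1 s r) *
            FreeAlgebra.ι K (HGen.vertex ((s h).get i)))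
        (FreeAlgebra.ι K (HGen.ghost h i j))
  | cuntz1 (h : H1) (i i' : Fin (s h).length) :
      Rel (∑ k : Fin (r h).length,
            FreeAlgebra.ι K (HGen.edge h i k : HGen H0 H1 s r) *
              FreeAlgebra.ι K (HGen.ghost h i' k))
        (if i = i' then FreeAlgebra.ι K (HGen.vertex ((s h).get i) : HGen H0 H1 s r) else 0)
  | cuntz2 (h : H1) (j j' : Fin (r h).length) :
      Rel (∑ k : Fin (s h).length,
            FreeAlgebra.ι K (HGen.ghost h k j : HGen H0 H1 s r) *
              FreeAlgebra.ι K (HGen.edge h k j'))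
        (if j = j' then FreeAlgebra.ι K (HGen.vertex ((r h).get j) : HGen H0 H1 s r) else 0)

/-- The universal unital algebra on the generators subject to the relations (i)-(iv);
it is the unitalization of the Leavitt path algebra of the hypergraph. -/
abbrev Ambient : Type := RingQuot (Rel K H0 H1 s r)

/-- The image of a generator in the ambient algebra. -/
noncomputable def amb (g : HGen H0 H1 s r) : Ambient K H0 H1 s r :=
  RingQuot.mkAlgHom K (Rel K H0 H1 s r) (FreeAlgebra.ι K g)

/-- The Leavitt path algebra of the hypergraph `(H0, H1, s, r)`, realized as the
non-unital subalgebra generated by the generators inside the universal unital algebra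
on the generators subject to the relations (i)-(iv). (This is the algebra presented,
in the category of not necessarily unital `K`-algebras, by said generators and
relations.) -/
noncomputable def LPAsub : NonUnitalSubalgebra K (Ambient K H0 H1 s r) :=
  NonUnitalAlgebra.adjoin K (Set.range (amb K H0 H1 s r))

/-- The Leavitt path algebra `L_K(H)` of the hypergraph `H = (H0, H1, s, r)`. -/
abbrev LPA : Type := ↥(LPAsub K H0 H1 s r)

variable {H0 H1 s r}

/-- A generator, as an element of the Leavitt path algebra. -/
noncomputable def genL (g : HGen H0 H1 s r) : LPA K H0 H1 s r :=
  ⟨amb K H0 H1 s r g, NonUnitalAlgebra.subset_adjoin K (Set.mem_range_self g)⟩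

/-- The vertex generator `v ∈ H0` as an element of the Leavitt path algebra. -/
noncomputable def vgen (v : H0) : LPA K H0 H1 s r := genL K (HGen.vertex v)

/-- The generator `h_{ij}` as an element of the Leavitt path algebra. -/
noncomputable def egen (h : H1) (i : Fin (s h).length) (j : Fin (r h).length) :
    LPA K H0 H1 s r := genL K (HGen.edge h i j)

/-- The generator `h_{ij}^*` as an element of the Leavitt path algebra. -/
noncomputable def ggen (h : H1) (i : Fin (s h).length) (j : Fin (r h).length) :
    LPA K H0 H1 s r := genL K (HGen.ghost h i j)

end HLPA

namespace HLPA

variable (K : Type) [Field K] (H0 H1 : Type) (s r : H1 → List H0)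

noncomputable instance instLPANonUnitalRing : NonUnitalRing (LPA K H0 H1 s r) :=
  NonUnitalSubalgebra.toNonUnitalRing (LPAsub K H0 H1 s r)

noncomputable instance instLPAAddCommGroup : AddCommGroup (LPA K H0 H1 s r) :=
  (instLPANonUnitalRing K H0 H1 s r).toAddCommGroup

noncomputable instance instLPAModule : Module K (LPA K H0 H1 s r) :=
  (LPAsub K H0 H1 s r).instModule

end HLPA

/-- `I` is a left ideal of the (not necessarily unital) ring `R`, encoded as a set. -/
def IsLeftIdealSet (R : Type) [NonUnitalRing R] (I : Set R) : Prop :=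
  0 ∈ I ∧ (∀ x ∈ I, ∀ y ∈ I, x + y ∈ I) ∧ (∀ x ∈ I, -x ∈ I) ∧
    (∀ (a : R), ∀ x ∈ I, a * x ∈ I)

/-- `I` is a right ideal of the (not necessarily unital) ring `R`, encoded as a set. -/
def IsRightIdealSet (R : Type) [NonUnitalRing R] (I : Set R) : Prop :=
  0 ∈ I ∧ (∀ x ∈ I, ∀ y ∈ I, x + y ∈ I) ∧ (∀ x ∈ I, -x ∈ I) ∧
    (∀ (a : R), ∀ x ∈ I, x * a ∈ I)

namespace HLPA

section Shift

variable (K : Type) [Field K]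

/-- The backward shift on sequences. -/
def bshift : Module.End K (ℕ → K) := LinearMap.funLeft K K Nat.succ

/-- The forward shift on sequences. -/
def fshift : Module.End K (ℕ → K) where
  toFun f n := Nat.casesOn n 0 f
  map_add' f g := by ext n; cases n <;> simp
  map_smul' c f := by ext n; cases n <;> simp

lemma bshift_fshift (f : ℕ → K) : bshift K (fshift K f) = f := rfl

lemma bshift_single_zero (c : K) : bshift K (Pi.single 0 c) = 0 := by
  ext n; simp [bshift, LinearMap.funLeft]

lemma bshift_single_succ (n : ℕ) (c : K) :
    bshift K (Pi.single (n + 1) c) = Pi.single n c := by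
  ext k; simp [bshift, LinearMap.funLeft, Pi.single_apply]

lemma fshift_single (n : ℕ) (c : K) : fshift K (Pi.single n c) = Pi.single (n + 1) c := by
  ext k; cases k <;> simp [fshift, Pi.single_apply]

lemma sub_shift_pow (n m : ℕ) :
    (1 - fshift K * bshift K) ((bshift K ^ n) (Pi.single m 1)) =
      if m = n then (Pi.single 0 1 : ℕ → K) else 0 := by
  induction n generalizing m with
  | zero =>
    cases m with
    | zero => simp [bshift_single_zero]
    | succ m => simp [bshift_single_succ, fshift_single]
  | succ n ih =>
    rw [pow_succ, Module.End.mul_apply]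
    cases m with
    | zero => simp [bshift_single_zero]
    | succ m => rw [bshift_single_succ, ih]; simp

end Shift

section Equivs

variable (K : Type) [Field K] {m n : ℕ}

/-- The linear equivalence between powers of the sequence space induced by a bijection of
the index sets. -/
def seqPowCongr (σ : Fin m × ℕ ≃ Fin n × ℕ) : (Fin m → ℕ → K) ≃ₗ[K] (Fin n → ℕ → K) :=
  (LinearEquiv.curry K K (Fin m) ℕ).symm ≪≫ₗ LinearEquiv.funCongrLeft K K σ.symm ≪≫ₗ
    LinearEquiv.curry K K (Fin n) ℕ

lemma seqPowCongr_apply (σ : Fin m × ℕ ≃ Fin n × ℕ) (f : Fin m → ℕ → K) (j : Fin n) (t : ℕ) :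
    seqPowCongr K σ f j t = f (σ.symm (j, t)).1 (σ.symm (j, t)).2 := rfl

lemma nonempty_seqPow_equiv (hm : 0 < m) (hn : 0 < n) :
    Nonempty ((Fin m → ℕ → K) ≃ₗ[K] (Fin n → ℕ → K)) := by
  have : NeZero m := ⟨hm.ne'⟩
  have : NeZero n := ⟨hn.ne'⟩
  obtain ⟨σ⟩ := nonempty_equiv_of_countable (α := Fin m × ℕ) (β := Fin n × ℕ)
  exact ⟨seqPowCongr K σ⟩

lemma infinite_fst_ne {i i' : Fin m} (hi : i' ≠ i) :
    Infinite ↥({x : Fin m × ℕ | x.1 = i}ᶜ) :=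
  Infinite.of_injective (fun t : ℕ => ⟨(i', t), hi⟩) fun a b h => by simpa using h

lemma exists_equiv_fixing {i i' : Fin m} {j j' : Fin n} (hi : i' ≠ i) (hj : j' ≠ j) :
    ∃ σ : Fin m × ℕ ≃ Fin n × ℕ, ∀ t, σ (i, t) = (j, t) := by
  let f : {x : Fin m × ℕ | x.1 = i} ↪ Fin n × ℕ :=
    ⟨fun x => (j, x.1.2), by
      rintro ⟨⟨a, b⟩, rfl⟩ ⟨⟨c, d⟩, hc⟩ h
      obtain rfl : c = a := hc
      simpa using h⟩
  have hf : Set.range f = {x : Fin n × ℕ | x.1 = j} := by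
    ext ⟨c, d⟩
    constructor
    · rintro ⟨x, hx⟩
      exact (congrArg Prod.fst hx).symm
    · rintro (rfl : c = j)
      exact ⟨⟨(i, d), rfl⟩, rfl⟩
  have h1 := infinite_fst_ne hi
  have h2 := infinite_fst_ne hj
  have : Nonempty (({x : Fin m × ℕ | x.1 = i}ᶜ : Set _) ≃ ((Set.range f)ᶜ : Set _)) := by
    rw [hf]
    exact nonempty_equiv_of_countable
  obtain ⟨g, hg⟩ := Cardinal.extend_function f this
  exact ⟨g, fun t => hg ⟨(i, t), rfl⟩⟩

lemma exists_seqPow_equiv_fixing {i i' : Fin m} {j j' : Fin n} (hi : i' ≠ i) (hj : j' ≠ j) :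
    ∃ P : (Fin m → ℕ → K) ≃ₗ[K] (Fin n → ℕ → K),
      (∀ f, P f j = f i) ∧ ∀ x, P.symm (Pi.single j x) = Pi.single i x := by
  obtain ⟨σ, hσ⟩ := exists_equiv_fixing hi hj
  have hσ' (t) : σ.symm (j, t) = (i, t) := by rw [← hσ, σ.symm_apply_apply]
  refine ⟨seqPowCongr K σ, fun f => ?_, fun x => ?_⟩
  · ext t
    rw [seqPowCongr_apply, hσ']
  · rw [LinearEquiv.symm_apply_eq]
    ext k t
    rw [seqPowCongr_apply]
    by_cases hk : k = j
    · subst hk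
      simp [hσ']
    · have : (σ.symm (k, t)).1 ≠ i := fun h => hk <| by
        have := hσ (σ.symm (k, t)).2
        rw [← h, Prod.mk.eta, σ.apply_symm_apply] at this
        exact congrArg Prod.fst this
      simp [hk, this]

/-- An automorphism of a power of the sequence space mixing two coordinates by the shifts. -/
def shiftMix (i i' : Fin m) (hi : i' ≠ i) : (Fin m → ℕ → K) ≃ₗ[K] (Fin m → ℕ → K) where
  toFun f k := if k = i then bshift K (f i') else if k = i' then
    fshift K (f i) + f i' - (fshift K (bshift K (f i')) + fshift K (bshift K (f i'))) else f k
  map_add' f g := by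
    ext k : 1
    simp only [Pi.add_apply, map_add]
    split_ifs <;> abel
  map_smul' c f := by
    ext k : 1
    simp only [Pi.smul_apply, map_smul, RingHom.id_apply]
    split_ifs <;> simp only [smul_add, smul_sub]
  invFun f k := if k = i then f i + bshift K (f i') else if k = i' then
    fshift K (f i) + f i' - fshift K (bshift K (f i')) else f k
  left_inv f := by
    ext k : 1
    by_cases h : k = i
    · subst h
      simp only [↓reduceIte, if_neg hi, map_add, map_sub, bshift_fshift]
      abel
    · by_cases h' : k = i'
      · subst h'
        simp only [↓reduceIte, if_neg hi, map_add, map_sub, bshift_fshift]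
        abel
      · simp [h, h']
  right_inv f := by
    ext k : 1
    by_cases h : k = i
    · subst h
      simp only [↓reduceIte, if_neg hi, map_add, map_sub, bshift_fshift]
      abel
    · by_cases h' : k = i'
      · subst h'
        simp only [↓reduceIte, if_neg hi, map_add, map_sub, bshift_fshift]
        abel
      · simp [h, h']

lemma exists_shift_equiv {i i' : Fin m} {j j' : Fin n} (hi : i' ≠ i) (hj : j' ≠ j) :
    ∃ Φ : (Fin m → ℕ → K) ≃ₗ[K] (Fin n → ℕ → K),
      (∀ x, Φ.symm (Pi.single j x) i = x) ∧ (∀ x, Φ.symm (Pi.single j x) i' = fshift K x) ∧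
        ∀ x, Φ (Pi.single i' x) j = bshift K x := by
  obtain ⟨P, hP, hP'⟩ := exists_seqPow_equiv_fixing K hi hj
  refine ⟨shiftMix K i i' hi ≪≫ₗ P, fun x => ?_, fun x => ?_, fun x => ?_⟩
  · simp [hP', shiftMix, hi]
  · simp [hP', shiftMix, hi]
  · simp [hP, shiftMix]

end Equivs

section Representation

variable (K : Type) [Field K] {H0 H1 : Type} {s r : H1 → List H0}

/-- The endomorphism of the space of families indexed by `H0` acting by `f` from the
component `v` to the component `u`, and by zero elsewhere. -/
noncomputable def unitEnd (u v : H0) (f : Module.End K (ℕ → K)) :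
    Module.End K (H0 → ℕ → K) :=
  LinearMap.single K (fun _ => ℕ → K) u ∘ₗ f ∘ₗ LinearMap.proj v

variable {K}

lemma unitEnd_apply (u v : H0) (f : Module.End K (ℕ → K)) (x : H0 → ℕ → K) :
    unitEnd K u v f x = Pi.single u (f (x v)) := rfl

lemma unitEnd_single (u v : H0) (f : Module.End K (ℕ → K)) (x : ℕ → K) :
    unitEnd K u v f (Pi.single v x) = Pi.single u (f x) := by
  rw [unitEnd_apply, Pi.single_eq_same]

lemma unitEnd_mul (u v w : H0) (f g : Module.End K (ℕ → K)) :
    unitEnd K u v f * unitEnd K v w g = unitEnd K u w (f * g) := by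
  ext1 x
  simp [unitEnd_apply]

lemma unitEnd_mul_of_ne (u w : H0) {v v' : H0} (h : v ≠ v') (f g : Module.End K (ℕ → K)) :
    unitEnd K u v f * unitEnd K v' w g = 0 := by
  refine LinearMap.ext fun x => ?_
  simp [unitEnd_apply, Pi.single_eq_of_ne h]

lemma unitEnd_sum {ι : Type} [Fintype ι] (u v : H0) (f : ι → Module.End K (ℕ → K)) :
    ∑ k, unitEnd K u v (f k) = unitEnd K u v (∑ k, f k) := by
  refine LinearMap.ext fun x => ?_
  simp only [LinearMap.sum_apply, unitEnd_apply]
  exact (map_sum (LinearMap.single K (fun _ : H0 => ℕ → K) u) _ _).symm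

lemma unitEnd_zero (u v : H0) : unitEnd K u v 0 = 0 := by
  refine LinearMap.ext fun x => ?_
  simp [unitEnd_apply]

/-- The matrix entries of a linear map between powers of the sequence space. -/
noncomputable def entry {m n : ℕ} (Φ : (Fin m → ℕ → K) ≃ₗ[K] (Fin n → ℕ → K))
    (i : Fin m) (j : Fin n) : Module.End K (ℕ → K) :=
  LinearMap.proj j ∘ₗ Φ.toLinearMap ∘ₗ LinearMap.single K (fun _ => ℕ → K) i

lemma entry_apply {m n : ℕ} (Φ : (Fin m → ℕ → K) ≃ₗ[K] (Fin n → ℕ → K))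
    (i : Fin m) (j : Fin n) (x : ℕ → K) : entry Φ i j x = Φ (Pi.single i x) j := by
  simp [entry]

lemma sum_entry_mul_entry {m n : ℕ} (Φ : (Fin m → ℕ → K) ≃ₗ[K] (Fin n → ℕ → K))
    (i i' : Fin m) :
    ∑ k, entry Φ.symm k i * entry Φ i' k = if i = i' then 1 else 0 := by
  refine LinearMap.ext fun x => ?_
  simp only [LinearMap.sum_apply, Module.End.mul_apply, entry_apply]
  rw [← Finset.sum_apply, ← map_sum, Finset.univ_sum_single, Φ.symm_apply_apply]
  split_ifs with h
  · simp [h]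
  · simp [h]

variable (Φ : ∀ h, (Fin (s h).length → ℕ → K) ≃ₗ[K] (Fin (r h).length → ℕ → K))

/-- The images of the generators under the representation defined by `Φ`. -/
noncomputable def repGen : HGen H0 H1 s r → Module.End K (H0 → ℕ → K)
  | .vertex v => unitEnd K v v 1
  | .edge h i j => unitEnd K ((s h).get i) ((r h).get j) (entry (Φ h).symm j i)
  | .ghost h i j => unitEnd K ((r h).get j) ((s h).get i) (entry (Φ h) i j)

/-- The representation defined by a family of linear equivalences. -/
noncomputable def rep : Ambient K H0 H1 s r →ₐ[K] Module.End K (H0 → ℕ → K) :=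
  RingQuot.liftAlgHom K ⟨FreeAlgebra.lift K (repGen Φ), by
    intro x y hxy
    induction hxy with
    | vtx u v =>
      by_cases h : u = v
      · subst h
        simp [repGen, unitEnd_mul]
      · simp [h, repGen, unitEnd_mul_of_ne]
    | src_edge h i j => simp only [map_mul, FreeAlgebra.lift_ι_apply, repGen, unitEnd_mul, one_mul]
    | edge_rng h i j => simp only [map_mul, FreeAlgebra.lift_ι_apply, repGen, unitEnd_mul, mul_one]
    | rng_ghost h i j => simp only [map_mul, FreeAlgebra.lift_ι_apply, repGen, unitEnd_mul, one_mul]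
    | ghost_src h i j => simp only [map_mul, FreeAlgebra.lift_ι_apply, repGen, unitEnd_mul, mul_one]
    | cuntz1 h i i' =>
      simp only [map_sum, map_mul, FreeAlgebra.lift_ι_apply, repGen, unitEnd_mul, unitEnd_sum,
        sum_entry_mul_entry]
      by_cases hi : i = i'
      · subst hi
        simp [repGen]
      · simp [hi, unitEnd_zero]
    | cuntz2 h j j' =>
      have := sum_entry_mul_entry (Φ h).symm j j'
      rw [LinearEquiv.symm_symm] at this
      simp only [map_sum, map_mul, FreeAlgebra.lift_ι_apply, repGen, unitEnd_mul, unitEnd_sum,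
        this]
      by_cases hi : j = j'
      · subst hi
        simp [repGen]
      · simp [hi, unitEnd_zero]⟩

lemma rep_amb (g : HGen H0 H1 s r) : rep Φ (amb K H0 H1 s r g) = repGen Φ g := by
  rw [rep, amb, RingQuot.liftAlgHom_mkAlgHom_apply, FreeAlgebra.lift_ι_apply]

end Representation

section Involution

variable {K : Type} [Field K] {H0 H1 : Type} {s r : H1 → List H0}

/-- The involution on generators. -/
def starGen : HGen H0 H1 s r → HGen H0 H1 s r
  | .vertex v => .vertex v
  | .edge h i j => .ghost h i j
  | .ghost h i j => .edge h i j

lemma mkAlgHom_ι (g : HGen H0 H1 s r) :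
    RingQuot.mkAlgHom K (Rel K H0 H1 s r) (FreeAlgebra.ι K g) = amb K H0 H1 s r g := rfl

variable (K H0 H1 s r) in
/-- The anti-automorphism of the ambient algebra exchanging `h_{ij}` and `h_{ij}^*`. -/
noncomputable def invol : Ambient K H0 H1 s r →ₐ[K] (Ambient K H0 H1 s r)ᵐᵒᵖ :=
  RingQuot.liftAlgHom K ⟨FreeAlgebra.lift K fun g => .op (amb K H0 H1 s r (starGen g)), by
    intro x y hxy
    induction hxy with
    | vtx u v =>
      have h := RingQuot.mkAlgHom_rel K (Rel.vtx (K := K) (s := s) (r := r) v u)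
      by_cases huv : u = v
      · subst huv
        simp only [↓reduceIte, map_mul, mkAlgHom_ι] at h
        simp [starGen, ← MulOpposite.op_mul, h]
      · simp only [if_neg (Ne.symm huv), map_mul, mkAlgHom_ι, map_zero] at h
        simp [starGen, ← MulOpposite.op_mul, h, huv]
    | src_edge h i j =>
      have h := RingQuot.mkAlgHom_rel K (Rel.ghost_src (K := K) h i j)
      simp only [map_mul, mkAlgHom_ι] at h
      simp only [map_mul, FreeAlgebra.lift_ι_apply, starGen, ← MulOpposite.op_mul, h]
    | edge_rng h i j =>
      have h := RingQuot.mkAlgHom_rel K (Rel.rng_ghost (K := K) h i j)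
      simp only [map_mul, mkAlgHom_ι] at h
      simp only [map_mul, FreeAlgebra.lift_ι_apply, starGen, ← MulOpposite.op_mul, h]
    | rng_ghost h i j =>
      have h := RingQuot.mkAlgHom_rel K (Rel.edge_rng (K := K) h i j)
      simp only [map_mul, mkAlgHom_ι] at h
      simp only [map_mul, FreeAlgebra.lift_ι_apply, starGen, ← MulOpposite.op_mul, h]
    | ghost_src h i j =>
      have h := RingQuot.mkAlgHom_rel K (Rel.src_edge (K := K) h i j)
      simp only [map_mul, mkAlgHom_ι] at h
      simp only [map_mul, FreeAlgebra.lift_ι_apply, starGen, ← MulOpposite.op_mul, h]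
    | cuntz1 h i i' =>
      have h := RingQuot.mkAlgHom_rel K (Rel.cuntz1 (K := K) (r := r) h i' i)
      by_cases hi : i = i'
      · subst hi
        simp only [↓reduceIte, map_mul, map_sum, mkAlgHom_ι] at h
        simp only [↓reduceIte, map_sum, map_mul, FreeAlgebra.lift_ι_apply, starGen,
          ← MulOpposite.op_mul, ← Finset.op_sum, h]
      · simp only [if_neg (Ne.symm hi), map_mul, map_sum, mkAlgHom_ι, map_zero] at h
        simp only [if_neg hi, map_sum, map_mul, FreeAlgebra.lift_ι_apply, starGen, map_zero,
          ← MulOpposite.op_mul, ← Finset.op_sum, h, MulOpposite.op_zero]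
    | cuntz2 h j j' =>
      have h := RingQuot.mkAlgHom_rel K (Rel.cuntz2 (K := K) (s := s) h j' j)
      by_cases hi : j = j'
      · subst hi
        simp only [↓reduceIte, map_mul, map_sum, mkAlgHom_ι] at h
        simp only [↓reduceIte, map_sum, map_mul, FreeAlgebra.lift_ι_apply, starGen,
          ← MulOpposite.op_mul, ← Finset.op_sum, h]
      · simp only [if_neg (Ne.symm hi), map_mul, map_sum, mkAlgHom_ι, map_zero] at h
        simp only [if_neg hi, map_sum, map_mul, FreeAlgebra.lift_ι_apply, starGen, map_zero,
          ← MulOpposite.op_mul, ← Finset.op_sum, h, MulOpposite.op_zero]⟩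

lemma invol_amb (g : HGen H0 H1 s r) :
    invol K H0 H1 s r (amb K H0 H1 s r g) = .op (amb K H0 H1 s r (starGen g)) := by
  rw [invol, amb, RingQuot.liftAlgHom_mkAlgHom_apply, FreeAlgebra.lift_ι_apply]

lemma amb_mem (g : HGen H0 H1 s r) : amb K H0 H1 s r g ∈ LPAsub K H0 H1 s r :=
  NonUnitalAlgebra.subset_adjoin K (Set.mem_range_self g)

lemma invol_spec {x : Ambient K H0 H1 s r} (hx : x ∈ LPAsub K H0 H1 s r) :
    (invol K H0 H1 s r x).unop ∈ LPAsub K H0 H1 s r ∧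
      (invol K H0 H1 s r (invol K H0 H1 s r x).unop).unop = x := by
  induction hx using NonUnitalAlgebra.adjoin_induction with
  | mem x hx =>
    obtain ⟨g, rfl⟩ := hx
    rw [invol_amb, MulOpposite.unop_op, invol_amb, MulOpposite.unop_op]
    exact ⟨amb_mem _, by cases g <;> rfl⟩
  | add x y _ _ hx hy =>
    simp only [map_add, MulOpposite.unop_add, hx.2, hy.2, and_true]
    exact add_mem hx.1 hy.1
  | zero => simp
  | mul x y _ _ hx hy =>
    simp only [map_mul, MulOpposite.unop_mul, hx.2, hy.2, and_true]
    exact mul_mem hy.1 hx.1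
  | smul c x _ hx =>
    simp only [map_smul, MulOpposite.unop_smul, hx.2, and_true]
    exact SMulMemClass.smul_mem c hx.1

end Involution

section Chains

variable {K : Type} [Field K] {H0 H1 : Type} {s r : H1 → List H0}

lemma exists_chains_of_separating {W : Type} [AddCommGroup W] [Module K W]
    (ρ : Ambient K H0 H1 s r →ₐ[K] Module.End K W) (X : ℕ → Ambient K H0 H1 s r) (w : ℕ → W)
    (hX : ∀ n, X n ∈ LPAsub K H0 H1 s r) (hne : ∀ n, ρ (X n) (w n) ≠ 0)
    (hzero : ∀ n m, m ≠ n → ρ (X n) (w m) = 0) :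
    (∃ C : ℕ → Set (LPA K H0 H1 s r),
      (∀ n, IsLeftIdealSet (LPA K H0 H1 s r) (C n)) ∧ ∀ n, C n ⊂ C (n + 1)) ∧
    (∃ C : ℕ → Set (LPA K H0 H1 s r),
      (∀ n, IsRightIdealSet (LPA K H0 H1 s r) (C n)) ∧ ∀ n, C n ⊂ C (n + 1)) := by
  constructor
  · refine ⟨fun n => {x | ∀ m, n ≤ m → ρ x.1 (w m) = 0}, fun n => ⟨?_, ?_, ?_, ?_⟩, fun n => ?_⟩
    · intro m _
      change ρ 0 (w m) = 0
      simp
    · intro x hx y hy m hm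
      change ρ (x.1 + y.1) (w m) = 0
      simp [hx m hm, hy m hm]
    · intro x hx m hm
      change ρ (-x.1) (w m) = 0
      simp [hx m hm]
    · intro a x hx m hm
      change ρ (a.1 * x.1) (w m) = 0
      simp [hx m hm]
    · refine (Set.ssubset_iff_of_subset ?_).2 ?_
      · exact fun x hx m hm => hx m (by omega)
      exact ⟨⟨X n, hX n⟩, fun m hm => hzero n m (by omega), fun h => hne n (h n le_rfl)⟩
  · refine ⟨fun n => {x | ∀ m, n ≤ m → ρ (invol K H0 H1 s r x.1).unop (w m) = 0},
      fun n => ⟨?_, ?_, ?_, ?_⟩, fun n => ?_⟩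
    · intro m _
      change ρ (invol K H0 H1 s r 0).unop (w m) = 0
      simp
    · intro x hx y hy m hm
      change ρ (invol K H0 H1 s r (x.1 + y.1)).unop (w m) = 0
      simp [hx m hm, hy m hm]
    · intro x hx m hm
      change ρ (invol K H0 H1 s r (-x.1)).unop (w m) = 0
      simp [hx m hm]
    · intro a x hx m hm
      change ρ (invol K H0 H1 s r (x.1 * a.1)).unop (w m) = 0
      simp [hx m hm]
    · refine (Set.ssubset_iff_of_subset ?_).2 ?_
      · exact fun x hx m hm => hx m (by omega)
      have h2 := (invol_spec (hX n)).2
      refine ⟨⟨_, (invol_spec (hX n)).1⟩, fun m hm => ?_, fun h => ?_⟩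
      · change ρ (invol K H0 H1 s r (invol K H0 H1 s r (X n)).unop).unop (w m) = 0
        rw [h2]
        exact hzero n m (by omega)
      · have h' : ρ (invol K H0 H1 s r (invol K H0 H1 s r (X n)).unop).unop (w n) = 0 :=
          h n le_rfl
        rw [h2] at h'
        exact hne n h'

lemma exists_chains_of_shift
    (Φ : ∀ h, (Fin (s h).length → ℕ → K) ≃ₗ[K] (Fin (r h).length → ℕ → K)) (v : H0)
    {A D : Ambient K H0 H1 s r} (hA : A ∈ LPAsub K H0 H1 s r) (hD : D ∈ LPAsub K H0 H1 s r)
    (hAv : ∀ x, rep Φ A (Pi.single v x) = Pi.single v (bshift K x))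
    (hDv : ∀ x, rep Φ D (Pi.single v x) = Pi.single v (fshift K (bshift K x))) :
    (∃ C : ℕ → Set (LPA K H0 H1 s r),
      (∀ n, IsLeftIdealSet (LPA K H0 H1 s r) (C n)) ∧ ∀ n, C n ⊂ C (n + 1)) ∧
    (∃ C : ℕ → Set (LPA K H0 H1 s r),
      (∀ n, IsRightIdealSet (LPA K H0 H1 s r) (C n)) ∧ ∀ n, C n ⊂ C (n + 1)) := by
  have hpow (n : ℕ) (x : ℕ → K) :
      rep Φ (A ^ n) (Pi.single v x) = Pi.single v ((bshift K ^ n) x) := by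
    induction n generalizing x with
    | zero => simp
    | succ n ih => rw [pow_succ, map_mul, Module.End.mul_apply, hAv, ih, pow_succ,
        Module.End.mul_apply]
  have key (n m : ℕ) : rep Φ ((amb K H0 H1 s r (.vertex v) - D) * A ^ n)
      (Pi.single v (Pi.single m 1)) =
        Pi.single v (if m = n then (Pi.single 0 1 : ℕ → K) else 0) := by
    rw [← sub_shift_pow, map_mul, Module.End.mul_apply, hpow, map_sub, LinearMap.sub_apply, hDv,
      rep_amb, repGen, unitEnd_single, ← Pi.single_sub]
    rfl
  refine exists_chains_of_separating (rep Φ)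
    (fun n => (amb K H0 H1 s r (.vertex v) - D) * A ^ n)
    (fun m => Pi.single v (Pi.single m 1)) (fun n => ?_) (fun n => ?_) (fun n m hnm => ?_)
  · induction n with
    | zero => simpa using sub_mem (amb_mem _) hD
    | succ n ih => rw [pow_succ, ← mul_assoc]; exact mul_mem ih hA
  · simp only [key, ↓reduceIte]
    intro h
    simpa using congrFun (congrFun h v) 0
  · simp only [key, if_neg hnm, Pi.single_zero]

lemma exists_family_extending (hs : ∀ h, s h ≠ []) (hr : ∀ h, r h ≠ []) (h : H1)
    (Ψ : (Fin (s h).length → ℕ → K) ≃ₗ[K] (Fin (r h).length → ℕ → K)) :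
    ∃ Φ : ∀ h, (Fin (s h).length → ℕ → K) ≃ₗ[K] (Fin (r h).length → ℕ → K), Φ h = Ψ :=
  ⟨Function.update (fun h => (nonempty_seqPow_equiv K (List.length_pos_of_ne_nil (hs h))
    (List.length_pos_of_ne_nil (hr h))).some) h Ψ, Function.update_self ..⟩

lemma exists_ne_of_two_le {n : ℕ} (hn : 2 ≤ n) (i : Fin n) : ∃ j, j ≠ i :=
  have : Nontrivial (Fin n) := Fin.nontrivial_iff_two_le.2 hn
  exists_ne i

lemma exists_get_eq_of_not_nodup {α : Type} {l : List α} (h : ¬ l.Nodup) :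
    ∃ i j, i ≠ j ∧ l.get i = l.get j := by
  rw [List.nodup_iff_injective_get, Function.Injective] at h
  push Not at h
  obtain ⟨i, j, h, hij⟩ := h
  exact ⟨i, j, hij, h⟩

end Chains

end HLPA

open HLPA in
/-- **Theorem 8.12.** Let `H` be a hypergraph that satisfies Condition (A'): there is an
`h ∈ H^1` with `|s(h)|, |r(h)| ≥ 2` such that moreover `s(h)` is a proper multiset
(has a repeated element), or `r(h)` is a proper multiset, or `s(h)` and `r(h)` are sets
(have no repeated elements) with nonempty intersection. Then `L_K(H)` is neither left
nor right Noetherian. -/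
theorem stmt_19 (K : Type) [Field K] (H0 H1 : Type) [Nonempty H0]
    (s r : H1 → List H0) (hs : ∀ h, s h ≠ []) (hr : ∀ h, r h ≠ [])
    (hA' : ∃ h : H1, 2 ≤ (s h).length ∧ 2 ≤ (r h).length ∧
      (¬ (s h).Nodup ∨ ¬ (r h).Nodup ∨
        ((s h).Nodup ∧ (r h).Nodup ∧ ∃ v : H0, v ∈ s h ∧ v ∈ r h))) :
    (∃ C : ℕ → Set (LPA K H0 H1 s r),
      (∀ n, IsLeftIdealSet (LPA K H0 H1 s r) (C n)) ∧ ∀ n, C n ⊂ C (n + 1)) ∧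
    (∃ C : ℕ → Set (LPA K H0 H1 s r),
      (∀ n, IsRightIdealSet (LPA K H0 H1 s r) (C n)) ∧ ∀ n, C n ⊂ C (n + 1)) := by
  obtain ⟨h, hs2, hr2, hrep | hrep | ⟨-, -, v, hvs, hvr⟩⟩ := hA'
  · obtain ⟨i', i, hi, hv⟩ := exists_get_eq_of_not_nodup hrep
    let j : Fin (r h).length := ⟨0, by omega⟩
    obtain ⟨j', hj⟩ := exists_ne_of_two_le hr2 j
    obtain ⟨Ψ, h1, h2, h3⟩ := exists_shift_equiv K hi hj
    obtain ⟨Φ, rfl⟩ := exists_family_extending hs hr h Ψ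
    refine exists_chains_of_shift Φ ((s h).get i')
      (A := amb K H0 H1 s r (.edge h i j) * amb K H0 H1 s r (.ghost h i' j))
      (D := amb K H0 H1 s r (.edge h i' j) * amb K H0 H1 s r (.ghost h i' j))
      (mul_mem (amb_mem _) (amb_mem _)) (mul_mem (amb_mem _) (amb_mem _))
      (fun x => ?_) (fun x => ?_)
    · rw [map_mul, Module.End.mul_apply, rep_amb, rep_amb, repGen, repGen, unitEnd_single,
        unitEnd_single, entry_apply, entry_apply, h3, h1, hv]
    · rw [map_mul, Module.End.mul_apply, rep_amb, rep_amb, repGen, repGen, unitEnd_single,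
        unitEnd_single, entry_apply, entry_apply, h3, h2]
  · obtain ⟨j', j, hj, hv⟩ := exists_get_eq_of_not_nodup hrep
    let i : Fin (s h).length := ⟨0, by omega⟩
    obtain ⟨i', hi⟩ := exists_ne_of_two_le hs2 i
    obtain ⟨Ψ, h1, h2, h3⟩ := exists_shift_equiv K hj hi
    obtain ⟨Φ, hΦ⟩ := exists_family_extending hs hr h Ψ.symm
    obtain rfl : (Φ h).symm = Ψ := by rw [hΦ, LinearEquiv.symm_symm]
    rw [LinearEquiv.symm_symm] at h1 h2
    refine exists_chains_of_shift Φ ((r h).get j')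
      (A := amb K H0 H1 s r (.ghost h i j) * amb K H0 H1 s r (.edge h i j'))
      (D := amb K H0 H1 s r (.ghost h i j') * amb K H0 H1 s r (.edge h i j'))
      (mul_mem (amb_mem _) (amb_mem _)) (mul_mem (amb_mem _) (amb_mem _))
      (fun x => ?_) (fun x => ?_)
    · rw [map_mul, Module.End.mul_apply, rep_amb, rep_amb, repGen, repGen, unitEnd_single,
        unitEnd_single, entry_apply, entry_apply, h3, h1, hv]
    · rw [map_mul, Module.End.mul_apply, rep_amb, rep_amb, repGen, repGen, unitEnd_single,
        unitEnd_single, entry_apply, entry_apply, h3, h2]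
  · obtain ⟨i', rfl⟩ := List.get_of_mem hvs
    obtain ⟨j, hv⟩ := List.get_of_mem hvr
    obtain ⟨i, hi⟩ := exists_ne_of_two_le hs2 i'
    obtain ⟨j', hj⟩ := exists_ne_of_two_le hr2 j
    obtain ⟨Ψ, -, h2, h3⟩ := exists_shift_equiv K hi.symm hj
    obtain ⟨Φ, rfl⟩ := exists_family_extending hs hr h Ψ
    refine exists_chains_of_shift Φ ((s h).get i')
      (A := amb K H0 H1 s r (.ghost h i' j))
      (D := amb K H0 H1 s r (.edge h i' j) * amb K H0 H1 s r (.ghost h i' j))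
      (amb_mem _) (mul_mem (amb_mem _) (amb_mem _))
      (fun x => ?_) (fun x => ?_)
    · rw [rep_amb, repGen, unitEnd_single, entry_apply, h3, hv]
    · rw [map_mul, Module.End.mul_apply, rep_amb, rep_amb, repGen, repGen, unitEnd_single,
        unitEnd_single, entry_apply, entry_apply, h3, h2]
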